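/- arXiv:2210.09967 — 2 statements merged into one kernel-verified Lean document; each statement's English description precedes it below -/
import Mathlib

section
/- Let l ≥ 0 and k be integers with l + k even and |k| ≤ l, and consider all sequences δ : Fin l → ℤ with values in {+1, −1} and total sum Σᵢ δ(i) = k. Define Φ(δ) = Σ_{i=0}^{l−1} Σ_{j ≤ i} δ(j), the sum of all partial sums of δ. Then Φ attains its minimum over this set uniquely at the sequence δ_min given by δ_min(i) = −1 for i < (l − k)/2 and δ_min(i) = +1 for i ≥ (l − k)/2. -/
theorem sum_range_ite_lt_neg_one_one (m : ℤ) (hm : 0 ≤ m) (n : ℕ) :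
    ∑ i ∈ Finset.range n, (if (i : ℤ) < m then (-1 : ℤ) else 1) = n - 2 * min (n : ℤ) m := by
  induction n with
  | zero => simp [hm]
  | succ n ih =>
    rw [Finset.sum_range_succ, ih]
    push_cast
    split_ifs <;> omega

theorem sum_partial_sums_eq {l : ℕ} (f : Fin l → ℤ) :
    ∑ i : Fin l, ∑ j ∈ Finset.univ.filter (fun j => j ≤ i), f j =
      ∑ j : Fin l, ((l : ℤ) - j) * f j := by
  simp only [Finset.sum_filter]
  rw [Finset.sum_comm]
  refine Finset.sum_congr rfl fun j _ => ?_
  rw [← Finset.sum_filter, Finset.sum_const, Finset.filter_le_eq_Ici, Fin.card_Ici,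
    nsmul_eq_mul, Nat.cast_sub j.isLt.le]


/-- Among all `±1`-valued sequences `δ : Fin l → ℤ` with total sum `k`
(where `l + k` is even and `|k| ≤ l`), the sum of all partial sums
`Φ(δ) = ∑_{i=0}^{l-1} ∑_{j ≤ i} δ(j)` attains its minimum uniquely at the sequence
`δ_min` equal to `-1` on the first `(l - k)/2` positions and `+1` afterwards. -/
theorem sum_partial_sums_min_unique
    (l : ℕ) (k : ℤ) (hpar : Even ((l : ℤ) + k)) (hk : |k| ≤ (l : ℤ)) :
    (∀ i : Fin l,
        ((if (i : ℤ) < ((l : ℤ) - k) / 2 then (-1 : ℤ) else 1) = 1 ∨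
         (if (i : ℤ) < ((l : ℤ) - k) / 2 then (-1 : ℤ) else 1) = -1)) ∧
    (∑ i : Fin l, (if (i : ℤ) < ((l : ℤ) - k) / 2 then (-1 : ℤ) else 1)) = k ∧
    ∀ δ : Fin l → ℤ, (∀ i, δ i = 1 ∨ δ i = -1) → (∑ i, δ i = k) →
      (∑ i : Fin l, ∑ j ∈ Finset.univ.filter (fun j => j ≤ i),
          (if (j : ℤ) < ((l : ℤ) - k) / 2 then (-1 : ℤ) else 1)) ≤
        (∑ i : Fin l, ∑ j ∈ Finset.univ.filter (fun j => j ≤ i), δ j) ∧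
      ((∑ i : Fin l, ∑ j ∈ Finset.univ.filter (fun j => j ≤ i), δ j) =
          (∑ i : Fin l, ∑ j ∈ Finset.univ.filter (fun j => j ≤ i),
            (if (j : ℤ) < ((l : ℤ) - k) / 2 then (-1 : ℤ) else 1)) →
        δ = fun i : Fin l => if ((i : ℕ) : ℤ) < ((l : ℤ) - k) / 2 then (-1 : ℤ) else 1) := by
  have hk' := abs_le.mp hk
  obtain ⟨c, hc⟩ := hpar
  obtain ⟨m, hm⟩ : ∃ m, m = ((l : ℤ) - k) / 2 := ⟨_, rfl⟩
  have hm2 : 2 * m = l - k := by omega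
  simp only [← hm]
  set μ : Fin l → ℤ := fun i => if ((i : ℕ) : ℤ) < m then (-1 : ℤ) else 1 with hμ
  have hsum : ∑ i, μ i = k := by
    rw [hμ, Fin.sum_univ_eq_sum_range (fun i : ℕ => if (i : ℤ) < m then (-1 : ℤ) else 1) l,
      sum_range_ite_lt_neg_one_one m (by omega)]
    omega
  refine ⟨fun i => by split_ifs <;> simp, hsum, fun δ hδ hδk => ?_⟩
  -- The odd weight `2 * (m - j) - 1` never vanishes and has the sign of `δ j - μ j`.
  have hnonneg : ∀ j ∈ Finset.univ, 0 ≤ (2 * (m - (j : Fin l)) - 1) * (δ j - μ j) := by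
    intro j _
    by_cases h : ((j : ℕ) : ℤ) < m
    · rcases hδ j with hj | hj <;> simp only [hμ, h, if_true, hj] <;> omega
    · rcases hδ j with hj | hj <;> simp only [hμ, h, if_false, hj] <;> omega
  have hdiff : ∑ j : Fin l, (2 * (m - j) - 1) * (δ j - μ j) =
      2 * (∑ j : Fin l, ((l : ℤ) - j) * δ j - ∑ j : Fin l, ((l : ℤ) - j) * μ j) := by
    have hzero : ∑ j, (2 * (m - l) - 1) * (δ j - μ j) = 0 := by
      rw [← Finset.mul_sum, Finset.sum_sub_distrib, hδk, hsum, sub_self, mul_zero]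
    rw [← Finset.sum_sub_distrib, Finset.mul_sum, ← sub_eq_zero, ← Finset.sum_sub_distrib,
      ← hzero]
    exact Finset.sum_congr rfl fun j _ => by ring
  have hpos := Finset.sum_nonneg hnonneg
  rw [sum_partial_sums_eq δ, sum_partial_sums_eq μ]
  refine ⟨by omega, fun heq => funext fun j => ?_⟩
  rw [heq, sub_self, mul_zero] at hdiff
  rcases mul_eq_zero.mp ((Finset.sum_eq_zero_iff_of_nonneg hnonneg).mp hdiff j
    (Finset.mem_univ j)) with h | h
  · omega
  · exact sub_eq_zero.mp h
end

section
/- Let l ≥ 2 and let δ, δ′ : Fin l → ℤ be sequences with all values in {+1, −1}. Say δ′ is obtained from δ by an admissible move if there exist indices i < j with δ′(i) = δ(i) − 2, δ′(j) = δ(j) + 2, and δ′(k) = δ(k) for all k ∉ {i, j}. Fix m with m + 1 < l and let s denote precomposition with the transposition of m and m+1 (so (δ ∘ s)(m) = δ(m+1), (δ ∘ s)(m+1) = δ(m), and δ ∘ s agrees with δ elsewhere). If δ′ is obtained from δ by an admissible move and δ′ ≠ δ ∘ s, then δ′ ∘ s is obtained from δ ∘ s by an admissible move. -/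
/-- `δ'` is obtained from `δ` by an *admissible move*: there are indices `i < j` with
`δ' i = δ i - 2`, `δ' j = δ j + 2`, and `δ' = δ` at all other positions. -/
def AdmissibleMove {l : ℕ} (δ δ' : Fin l → ℤ) : Prop :=
  ∃ i j : Fin l, i < j ∧ δ' i = δ i - 2 ∧ δ' j = δ j + 2 ∧
    ∀ k : Fin l, k ≠ i → k ≠ j → δ' k = δ k

/-- An adjacent transposition preserves the order of every pair other than the one it swaps. -/
theorem swap_lt_swap_of_adjacent {l : ℕ} {a b i j : Fin l} (hab : (a : ℕ) + 1 = b)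
    (hij : i < j) (h : ¬(i = a ∧ j = b)) : Equiv.swap a b i < Equiv.swap a b j := by
  simp only [Equiv.swap_apply_def]
  split_ifs <;> simp only [Fin.ext_iff, Fin.lt_def] at * <;> omega

/-- Reindexing by a permutation that keeps the moved pair in order preserves an admissible move. -/
theorem admissibleMove_comp_perm {l : ℕ} {δ δ' : Fin l → ℤ} (σ : Equiv.Perm (Fin l))
    {i j : Fin l} (hlt : σ.symm i < σ.symm j) (hi : δ' i = δ i - 2) (hj : δ' j = δ j + 2)
    (hk : ∀ k, k ≠ i → k ≠ j → δ' k = δ k) : AdmissibleMove (δ ∘ σ) (δ' ∘ σ) := by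
  refine ⟨σ.symm i, σ.symm j, hlt, by simpa using hi, by simpa using hj, fun k hki hkj => ?_⟩
  exact hk (σ k) (fun h => hki (by simp [← h])) (fun h => hkj (by simp [← h]))

/-- Let `l ≥ 2` and `δ, δ' : Fin l → ℤ` be `±1`-valued. Fix `m` with
`m + 1 < l` and let `s` be precomposition with the transposition of `m` and `m + 1`.
If `δ'` is obtained from `δ` by an admissible move and `δ' ≠ δ ∘ s`, then
`δ' ∘ s` is obtained from `δ ∘ s` by an admissible move. -/
theorem admissibleMove_comp_swap
    (l : ℕ) (hl : 2 ≤ l) (δ δ' : Fin l → ℤ)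
    (hδ : ∀ i, δ i = 1 ∨ δ i = -1) (hδ' : ∀ i, δ' i = 1 ∨ δ' i = -1)
    (m : ℕ) (hm : m + 1 < l)
    (hmove : AdmissibleMove δ δ')
    (hne : δ' ≠ δ ∘ (Equiv.swap ⟨m, Nat.lt_of_succ_lt hm⟩ ⟨m + 1, hm⟩)) :
    AdmissibleMove
      (δ ∘ (Equiv.swap ⟨m, Nat.lt_of_succ_lt hm⟩ ⟨m + 1, hm⟩))
      (δ' ∘ (Equiv.swap ⟨m, Nat.lt_of_succ_lt hm⟩ ⟨m + 1, hm⟩)) := by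
  obtain ⟨i, j, hij, hi, hj, hk⟩ := hmove
  refine admissibleMove_comp_perm _ ?_ hi hj hk
  rw [Equiv.symm_swap]
  refine swap_lt_swap_of_adjacent rfl hij ?_
  rintro ⟨rfl, rfl⟩
  refine hne (funext fun k => ?_)
  have h₁ := hδ ⟨m, Nat.lt_of_succ_lt hm⟩
  have h₂ := hδ' ⟨m, Nat.lt_of_succ_lt hm⟩
  have h₃ := hδ ⟨m + 1, hm⟩
  have h₄ := hδ' ⟨m + 1, hm⟩
  rw [Function.comp_apply, Equiv.swap_apply_def]
  split_ifs with hkm hkm'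
  · subst hkm; omega
  · subst hkm'; omega
  · exact hk k hkm hkm'
end
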